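/- (Index identity from the proof of Proposition 4.2) For every i with 1 ≤ i ≤ k, setting α = u_1 + ⋯ + u_i, one has σ + n − α + 1 = u_1 + ⋯ + u_{k+1−i} (where n = u_1 − 1 and σ = u_1 + ⋯ + u_k). -/

import Mathlib

open Finset

/-- The set `F = { l / w j : 0 ≤ l ≤ w j - 1, 0 ≤ j ≤ n }` of rational numbers. -/
def wpF (n : ℕ) (w : Fin (n + 1) → ℕ) : Finset ℚ :=
  (Finset.univ.sigma fun j : Fin (n + 1) => Finset.range (w j)).image
    fun p => (p.2 : ℚ) / (w p.1 : ℚ)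

-- The set `S f = { j ∈ {0,…,n} : w j · f ∈ ℤ }`.
open Classical in
noncomputable def wpS (n : ℕ) (w : Fin (n + 1) → ℕ) (x : ℚ) : Finset (Fin (n + 1)) :=
  Finset.univ.filter fun j => ∃ z : ℤ, (w j : ℚ) * x = (z : ℚ)

theorem mem_wpS {n : ℕ} {w : Fin (n + 1) → ℕ} {x : ℚ} {j : Fin (n + 1)} :
    j ∈ wpS n w x ↔ ∃ z : ℤ, (w j : ℚ) * x = z := by
  simp [wpS]

theorem wpS_one_sub (n : ℕ) (w : Fin (n + 1) → ℕ) (x : ℚ) : wpS n w (1 - x) = wpS n w x := by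
  ext j
  simp only [mem_wpS]
  constructor
  · rintro ⟨z, hz⟩
    exact ⟨w j - z, by push_cast; linarith⟩
  · rintro ⟨z, hz⟩
    exact ⟨w j - z, by push_cast; linarith⟩

theorem wpS_zero (n : ℕ) (w : Fin (n + 1) → ℕ) : wpS n w 0 = univ := by
  ext j
  simpa [mem_wpS] using ⟨0, by simp⟩

theorem exists_lt_div_eq_iff {m : ℕ} (hm : 0 < m) {x : ℚ} :
    (∃ l < m, (l : ℚ) / m = x) ↔ (0 ≤ x ∧ x < 1) ∧ ∃ z : ℤ, (m : ℚ) * x = z := by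
  have hm' : (0 : ℚ) < m := by exact_mod_cast hm
  constructor
  · rintro ⟨l, hl, rfl⟩
    refine ⟨⟨by positivity, ?_⟩, l, ?_⟩
    · rw [div_lt_one hm']
      exact_mod_cast hl
    · push_cast
      field_simp
  · rintro ⟨⟨h0, h1⟩, z, hz⟩
    have hz0 : 0 ≤ z := by
      have : (0 : ℚ) ≤ z := hz ▸ mul_nonneg hm'.le h0
      exact_mod_cast this
    lift z to ℕ using hz0
    push_cast at hz
    refine ⟨z, ?_, ?_⟩
    · have : (z : ℚ) < m := hz ▸ mul_lt_of_lt_one_right hm' h1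
      exact_mod_cast this
    · rw [← hz]
      field_simp

theorem mem_wpF {n : ℕ} {w : Fin (n + 1) → ℕ} (hw : ∀ j, 0 < w j) {x : ℚ} :
    x ∈ wpF n w ↔ (0 ≤ x ∧ x < 1) ∧ (wpS n w x).Nonempty := by
  have h : x ∈ wpF n w ↔ ∃ j, ∃ l < w j, (l : ℚ) / w j = x := by
    simp [wpF, Sigma.exists]
  simp only [h, exists_lt_div_eq_iff (hw _), Finset.Nonempty, mem_wpS, exists_and_left]

theorem sum_card_wpS {n : ℕ} {w : Fin (n + 1) → ℕ} (hw : ∀ j, 0 < w j) :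
    ∑ x ∈ wpF n w, (wpS n w x).card = ∑ j, w j := by
  classical
  simp only [wpS, card_filter]
  rw [sum_comm]
  refine sum_congr rfl fun j _ => ?_
  rw [← card_filter]
  have h : {x ∈ wpF n w | ∃ z : ℤ, (w j : ℚ) * x = z} =
      (range (w j)).image fun l : ℕ => (l : ℚ) / w j := by
    ext x
    simp only [mem_filter, mem_image, mem_range, exists_lt_div_eq_iff (hw j), mem_wpF hw]
    exact ⟨fun h => ⟨h.1.1, h.2⟩, fun h => ⟨⟨h.1, j, mem_wpS.2 h.2⟩, h.2⟩⟩
  have hj : (w j : ℚ) ≠ 0 := by exact_mod_cast (hw j).ne'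
  rw [h, card_image_of_injective, card_range]
  intro a b hab
  exact_mod_cast (div_left_inj' hj).1 hab

/-- A strictly increasing enumeration `f 1, …, f m` whose set of values is stable under
`x ↦ 1 - x` satisfies `f (m + 1 - l) = 1 - f l`. -/
theorem enum_one_sub {m : ℕ} {f : ℕ → ℚ}
    (hmono : ∀ i j : ℕ, 1 ≤ i → i < j → j ≤ m → f i < f j)
    (hsymm : ∀ i : ℕ, 1 ≤ i → i ≤ m → ∃ j : ℕ, 1 ≤ j ∧ j ≤ m ∧ f j = 1 - f i)
    {l : ℕ} (hl : 1 ≤ l) (hlm : l ≤ m) : f (m + 1 - l) = 1 - f l := by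
  let g : Fin m → ℚ := fun a => f (a + 1)
  have hg : StrictMono g := fun a b hab => hmono _ _ (by omega) (by simpa using hab) (by omega)
  have hcard : (univ.image g).card = m := by
    rw [card_image_of_injective _ hg.injective, card_univ, Fintype.card_fin]
  let g' : Fin m → ℚ := fun a => 1 - f (m - a)
  have hg' : StrictMono g' := fun a b hab =>
    sub_lt_sub_left (hmono _ _ (by omega) (by omega) (by omega)) 1
  have hmem : ∀ a, g' a ∈ univ.image g := fun a => by
    obtain ⟨j, hj, hjm, h⟩ := hsymm (m - a) (by omega) (by omega)
    refine mem_image.2 ⟨⟨j - 1, by omega⟩, mem_univ _, ?_⟩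
    simp only [g, g', ← h]
    congr 1
    omega
  have h := congrFun ((orderEmbOfFin_unique hcard (fun a => mem_image_of_mem g (mem_univ a)) hg).trans
    (orderEmbOfFin_unique hcard hmem hg').symm) ⟨m - l, by omega⟩
  simp only [g, g'] at h
  rwa [show m - l + 1 = m + 1 - l by omega, show m - (m - l) = l by omega] at h

theorem index_identity (n k : ℕ) (w : Fin (n + 1) → ℕ) (hw : ∀ j, 0 < w j)
    (f : ℕ → ℚ)
    (hmono : ∀ i j : ℕ, 1 ≤ i → i < j → j ≤ k + 1 → f i < f j)
    (hmem : ∀ i : ℕ, 1 ≤ i → i ≤ k → f i ∈ wpF n w)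
    (hsurj : ∀ x ∈ wpF n w, ∃ i : ℕ, 1 ≤ i ∧ i ≤ k ∧ f i = x)
    (hf1 : f 1 = 0) (hfk1 : f (k + 1) = 1) :
    ∀ i : ℕ, 1 ≤ i → i ≤ k →
      (∑ j, w j) + n - (∑ l ∈ Finset.Icc 1 i, (wpS n w (f l)).card) + 1 =
        ∑ l ∈ Finset.Icc 1 (k + 1 - i), (wpS n w (f l)).card := by
  intro i hi hik
  have hS0 : wpS n w (f (k + 1)) = univ := by
    rw [hfk1, ← wpS_zero n w, ← wpS_one_sub, sub_self]
  have hF : ∀ l, 1 ≤ l → l ≤ k + 1 → (0 ≤ f l ∧ f l ≤ 1) ∧ (wpS n w (f l)).Nonempty := by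
    intro l hl hlk
    rcases hlk.lt_or_eq with h | rfl
    · obtain ⟨⟨h0, h1⟩, hne⟩ := (mem_wpF hw).1 (hmem l hl (by omega))
      exact ⟨⟨h0, h1.le⟩, hne⟩
    · rw [hS0, hfk1]
      exact ⟨by norm_num, univ_nonempty⟩
  have hsymm : ∀ l, 1 ≤ l → l ≤ k + 1 → ∃ j, 1 ≤ j ∧ j ≤ k + 1 ∧ f j = 1 - f l := by
    intro l hl hlk
    obtain ⟨⟨h0, h1⟩, hne⟩ := hF l hl hlk
    rcases h0.eq_or_lt with h | h
    · exact ⟨k + 1, by omega, le_rfl, by rw [hfk1, ← h, sub_zero]⟩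
    · obtain ⟨j, hj, hjk, hfj⟩ := hsurj (1 - f l)
        ((mem_wpF hw).2 ⟨⟨by linarith, by linarith⟩, by rwa [wpS_one_sub]⟩)
      exact ⟨j, hj, by omega, hfj⟩
  have htotal : ∑ l ∈ Icc 1 k, (wpS n w (f l)).card = ∑ j, w j := by
    rw [← sum_card_wpS hw]
    refine sum_bij (fun l _ => f l) ?_ ?_ ?_ fun _ _ => rfl
    · intro l hl
      rw [mem_Icc] at hl
      exact hmem l hl.1 hl.2
    · intro a ha b hb hab
      rw [mem_Icc] at ha hb
      rcases lt_trichotomy a b with h | h | h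
      · exact absurd hab (hmono a b ha.1 h (by omega)).ne
      · exact h
      · exact absurd hab (hmono b a hb.1 h (by omega)).ne'
    · intro x hx
      obtain ⟨l, hl, hlk, h⟩ := hsurj x hx
      exact ⟨l, mem_Icc.2 ⟨hl, hlk⟩, h⟩
  have htotal' : ∑ l ∈ Icc 1 (k + 1), (wpS n w (f l)).card = (∑ j, w j) + (n + 1) := by
    rw [sum_Icc_succ_top (by omega), htotal, hS0, card_univ, Fintype.card_fin]
  have hreflect : ∑ l ∈ Icc 1 i, (wpS n w (f l)).card =
      ∑ l ∈ Icc (k + 2 - i) (k + 1), (wpS n w (f l)).card := by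
    refine sum_bij' (fun l _ => k + 2 - l) (fun l _ => k + 2 - l) ?_ ?_ ?_ ?_ ?_
    · intro l hl; rw [mem_Icc] at *; omega
    · intro l hl; rw [mem_Icc] at *; omega
    · intro l hl; rw [mem_Icc] at hl; omega
    · intro l hl; rw [mem_Icc] at hl; omega
    · intro l hl
      rw [mem_Icc] at hl
      rw [enum_one_sub hmono hsymm hl.1 (by omega), wpS_one_sub]
  have hsplit : Icc 1 (k + 1) = Icc 1 (k + 1 - i) ∪ Icc (k + 2 - i) (k + 1) := by
    ext l; simp only [mem_union, mem_Icc]; omega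
  have hdisj : Disjoint (Icc 1 (k + 1 - i)) (Icc (k + 2 - i) (k + 1)) := by
    rw [disjoint_left]; intro l; simp only [mem_Icc]; omega
  rw [hsplit, sum_union hdisj, ← hreflect] at htotal'
  have hle : ∑ l ∈ Icc 1 i, (wpS n w (f l)).card ≤ ∑ j, w j :=
    htotal ▸ sum_le_sum_of_subset (Icc_subset_Icc_right hik)
  omega
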